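/- Let p ≥ 3 be a prime and let G be a group of order p^6 such that γ2(G) is elementary abelian of order p^4 and the center Z(G) has order p^2. Then K(G) ≠ γ2(G), i.e. some element of the commutator subgroup of G is not a commutator. -/

import Mathlib

open Subgroup
open scoped commutatorElement

lemma aux_lt_card {p n : ℕ} (hp : p.Prime) {G : Type*} [Group G] [Finite G]
    (hG : Nat.card G = p ^ n) {H K : Subgroup G} (h : H < K) :
    Nat.card H * p ≤ Nat.card K := by
  obtain ⟨i, hi, hi'⟩ := (Nat.dvd_prime_pow hp).1 (hG ▸ H.card_subgroup_dvd_card)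
  obtain ⟨j, hj, hj'⟩ := (Nat.dvd_prime_pow hp).1 (hG ▸ K.card_subgroup_dvd_card)
  have hlt : Nat.card H < Nat.card K := by
    by_contra hc
    exact h.ne (Subgroup.eq_of_le_of_card_ge h.le (not_lt.1 hc))
  rw [hi', hj'] at *
  have : i < j := (Nat.pow_lt_pow_iff_right hp.one_lt).1 hlt
  rw [← pow_succ]
  exact Nat.pow_le_pow_right hp.pos this

lemma aux_comm_sup {G : Type*} [Group G] (N K : Subgroup G) [N.Normal] [K.Normal] :
    ⁅N ⊔ K, (⊤ : Subgroup G)⁆ ≤ N ⊔ ⁅K, (⊤ : Subgroup G)⁆ := by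
  rw [commutator_le]
  intro x hx g _
  obtain ⟨n, hn, k, hk, rfl⟩ := Subgroup.mem_sup_of_normal_left.1 hx
  rw [commutatorElement_mul_left_eq_conj_mul]
  refine mul_mem ?_ ?_
  · exact mem_sup_right (Normal.conj_mem inferInstance _ (commutator_mem_commutator hk (mem_top g)) _)
  · exact mem_sup_left (commutator_le_left (H₁ := N) (H₂ := ⊤)
      (commutator_mem_commutator hn (mem_top g)))

lemma aux_nak {G : Type*} [Group G] [Group.IsNilpotent G] (U N : Subgroup G) [N.Normal]
    (h : U ≤ N ⊔ ⁅U, (⊤ : Subgroup G)⁆) : U ≤ N := by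
  obtain ⟨n, hn⟩ := Subgroup.nilpotent_iff_lowerCentralSeries.1 ‹_›
  have key : ∀ n, U ≤ N ⊔ (⊤ : Subgroup G).lowerCentralSeries n := by
    intro n
    induction n with
    | zero => simp
    | succ k ih =>
      refine h.trans (sup_le le_sup_left ?_)
      exact (commutator_mono ih le_rfl).trans (aux_comm_sup _ _)
  have := key n
  rwa [hn, sup_bot_eq] at this

lemma aux_mem_iff {G : Type*} [Group G] (N : Subgroup G) [N.Normal] (x y : G) :
    ⁅x, y⁆ ∈ N ↔ Commute (x : G ⧸ N) (y : G ⧸ N) := by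
  rw [← commutatorElement_eq_one_iff_commute, ← QuotientGroup.eq_one_iff]
  rfl

lemma aux_gen {G : Type*} [Group G] (N : Subgroup G) [N.Normal]
    (hN : ⁅commutator G, (⊤ : Subgroup G)⁆ ≤ N) {g h : G} (hgh : ⁅g, h⁆ ∈ N)
    (ht : zpowers g ⊔ zpowers h ⊔ commutator G = ⊤) : commutator G ≤ N := by
  have key : ∀ x : G, ⁅x, g⁆ ∈ N → ⁅x, h⁆ ∈ N → ∀ y, ⁅x, y⁆ ∈ N := by
    intro x h1 h2 y
    let C : Subgroup G := (centralizer {(x : G ⧸ N)}).comap (QuotientGroup.mk' N)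
    have hC : ∀ y, y ∈ C ↔ ⁅x, y⁆ ∈ N := by
      intro y
      rw [aux_mem_iff]
      simp only [C, mem_comap, mem_centralizer_singleton_iff]
      exact ⟨fun h => h.symm, fun h => h.symm⟩
    have : C = ⊤ := by
      rw [eq_top_iff, ← ht]
      refine sup_le (sup_le ?_ ?_) ?_
      · rw [zpowers_le, hC]; exact h1
      · rw [zpowers_le, hC]; exact h2
      · intro u hu
        rw [hC, ← commutatorElement_inv]
        exact inv_mem (hN (commutator_mem_commutator hu (mem_top x)))
    rw [← hC, this]; trivial
  have hg := key g (by simp [one_mem]) hgh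
  have hh := key h (by rw [← commutatorElement_inv]; exact inv_mem hgh) (by simp [one_mem])
  rw [commutator_def, commutator_le]
  intro x _ y _
  refine key x ?_ ?_ y
  · rw [← commutatorElement_inv]; exact inv_mem (hg x)
  · rw [← commutatorElement_inv]; exact inv_mem (hh x)

lemma aux_top {p : ℕ} (hp : p.Prime) {G : Type*} [Group G] [Finite G]
    (hG : Nat.card G = p ^ 6) (hcard : Nat.card (commutator G) = p ^ 4) {g h : G}
    (hg : g ∉ commutator G) (hh : h ∉ zpowers g ⊔ commutator G) :
    zpowers g ⊔ zpowers h ⊔ commutator G = ⊤ := by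
  have h1 : commutator G < zpowers g ⊔ commutator G :=
    lt_of_le_not_ge le_sup_right fun hc => hg (hc (mem_sup_left (mem_zpowers g)))
  have h2 : zpowers g ⊔ commutator G < zpowers g ⊔ zpowers h ⊔ commutator G :=
    lt_of_le_not_ge (sup_le_sup_right le_sup_left _)
      fun hc => hh (hc (mem_sup_left (mem_sup_right (mem_zpowers h))))
  have e1 := aux_lt_card hp hG h1
  have e2 := aux_lt_card hp hG h2
  apply eq_top_of_le_card
  rw [hG]
  rw [hcard] at e1
  calc p ^ 6 = p ^ 4 * p * p := by ring
    _ ≤ _ := (Nat.mul_le_mul_right p e1).trans e2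

lemma aux_card_sup {G : Type*} [Group G] [Finite G] (H N : Subgroup G) [N.Normal] :
    Nat.card ↥(H ⊔ N) ≤ Nat.card H * Nat.card N := by
  have := Set.natCard_mul_le (s := (H : Set G)) (t := (N : Set G))
  rwa [← Subgroup.mul_normal] at this

lemma aux_card_map {G H : Type*} [Group G] [Group H] [Finite G] (f : G →* H) (K : Subgroup G)
    (hK : f.ker ≤ K) : Nat.card (K.map f) * Nat.card f.ker = Nat.card K := by
  have h1 := Subgroup.card_mul_index (f.comp K.subtype).ker
  rw [Subgroup.index_ker, MonoidHom.range_comp, Subgroup.range_subtype, ← MonoidHom.comap_ker] at h1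
  have h2 : Nat.card (f.ker.comap K.subtype) = Nat.card f.ker :=
    Nat.card_congr (Subgroup.subgroupOfEquivOfLe hK).toEquiv
  rw [h2] at h1
  rw [mul_comm]; exact h1


lemma aux_cmul_right {G : Type*} [Group G]
    (hab : ∀ x ∈ commutator G, ∀ y ∈ commutator G, x * y = y * x) (g : G) {u v : G} (hu : u ∈ commutator G) (hv : v ∈ commutator G) :
    ⁅g, u * v⁆ = ⁅g, u⁆ * ⁅g, v⁆ := by
  rw [commutatorElement_mul_right_eq_mul_conj]
  have := hab u hu ⁅g, v⁆ (commutator_mem_commutator (mem_top _) (mem_top _))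
  rw [mul_assoc _ u, this]
  group

lemma aux_cmul_left {G : Type*} [Group G]
    (hab : ∀ x ∈ commutator G, ∀ y ∈ commutator G, x * y = y * x) (g : G) {u v : G} (hu : u ∈ commutator G) (hv : v ∈ commutator G) :
    ⁅g * u, v⁆ = ⁅g, v⁆ := by
  rw [commutatorElement_mul_left_eq_conj_mul, commutatorElement_eq_one_iff_mul_comm.2 (hab u hu v hv)]
  simp

lemma aux_conj {G : Type*} [Group G]
    (hab : ∀ x ∈ commutator G, ∀ y ∈ commutator G, x * y = y * x) (x g : G) {u : G} (hu : u ∈ commutator G) :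
    x * ⁅g, u⁆ * x⁻¹ = ⁅g, x * u * x⁻¹⁆ := by
  rw [conjugate_commutatorElement]
  have : x * g * x⁻¹ = g * ⁅g⁻¹, x⁆ := by simp only [commutatorElement_def]; group
  rw [this]
  exact aux_cmul_left hab g (commutator_mem_commutator (mem_top _) (mem_top _))
    (Normal.conj_mem inferInstance _ hu _)

/-- the hom `u ↦ ⁅g,u⁆` -/
def auxD {G : Type*} [Group G]
    (hab : ∀ x ∈ commutator G, ∀ y ∈ commutator G, x * y = y * x) (g : G) : commutator G →* G where
  toFun u := ⁅g, (u : G)⁆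
  map_one' := by simp
  map_mul' u v := aux_cmul_right hab g u.2 v.2

lemma aux_D_normal {G : Type*} [Group G]
    (hab : ∀ x ∈ commutator G, ∀ y ∈ commutator G, x * y = y * x) (g : G) : (auxD hab g).range.Normal := by
  constructor
  rintro _ ⟨u, rfl⟩ x
  exact ⟨⟨x * u * x⁻¹, Normal.conj_mem inferInstance _ u.2 _⟩, (aux_conj hab x g u.2).symm⟩

lemma aux_pow {G : Type*} [Group G]
    (hab : ∀ x ∈ commutator G, ∀ y ∈ commutator G, x * y = y * x) (g : G) {u : G} (hu : u ∈ commutator G) (k : ℤ) : ⁅g, u ^ k⁆ = ⁅g, u⁆ ^ k := by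
  have := map_zpow (auxD hab g) ⟨u, hu⟩ k
  exact this

/-- the hom `g ↦ ⁅g,c⁆` modulo `γ₄` -/
def auxPhi {G : Type*} [Group G]
    (hab : ∀ x ∈ commutator G, ∀ y ∈ commutator G, x * y = y * x) (c : G) (hc : c ∈ commutator G) :
    G →* G ⧸ ⁅⁅commutator G, (⊤ : Subgroup G)⁆, (⊤ : Subgroup G)⁆ where
  toFun g := (⁅g, c⁆ : G)
  map_one' := by simp
  map_mul' g h := by
    have h1 : ⁅h, c⁆ ∈ ⁅commutator G, (⊤ : Subgroup G)⁆ := by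
      rw [commutator_comm]; exact commutator_mem_commutator (mem_top _) hc
    have h2 : ⁅h, c⁆ ∈ commutator G := commutator_mem_commutator (mem_top _) (mem_top _)
    have h3 : ⁅g, c⁆ ∈ commutator G := commutator_mem_commutator (mem_top _) (mem_top _)
    have h4 : (⁅g, ⁅h, c⁆⁆ : G) ∈ ⁅⁅commutator G, (⊤ : Subgroup G)⁆, (⊤ : Subgroup G)⁆ := by
      rw [commutator_comm]; exact commutator_mem_commutator (mem_top _) h1
    have h5 : ⁅g * h, c⁆ = ⁅g, ⁅h, c⁆⁆ * (⁅g, c⁆ * ⁅h, c⁆) := by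
      rw [hab _ h3 _ h2]
      simp only [commutatorElement_def]; group
    rw [h5, QuotientGroup.mk_mul, (QuotientGroup.eq_one_iff _).2 h4, one_mul, QuotientGroup.mk_mul]


lemma aux_self {G : Type*} [Group G] (g u : G) (k : ℤ) :
    ⁅g, g ^ k * u⁆ = g ^ k * ⁅g, u⁆ * (g ^ k)⁻¹ := by
  simp only [commutatorElement_def]; group


/-- Lemma 2.4: Let `p ≥ 3` be a prime and `G` a group of order `p^6` with
`γ₂(G)` elementary abelian of order `p^4` and `|Z(G)| = p^2`. Then
`K(G) ≠ γ₂(G)`. -/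
theorem commutatorSet_ne_commutator_of_card_p6
    (p : ℕ) (hp : p.Prime) (hp3 : 3 ≤ p)
    (G : Type*) [Group G] [Finite G] (hG : Nat.card G = p ^ 6)
    (hcard : Nat.card (commutator G) = p ^ 4)
    (hab : ∀ x ∈ commutator G, ∀ y ∈ commutator G, x * y = y * x)
    (hexp : Monoid.exponent ↥(commutator G) = p)
    (hZ : Nat.card (Subgroup.center G) = p ^ 2) :
    commutatorSet G ≠ (commutator G : Set G) := by
  have hnil : Group.IsNilpotent G := by
    have := Fact.mk hp
    exact (IsPGroup.of_card hG).isNilpotent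
  have hcm : ∀ g h : G, ⁅g, h⁆ ∈ commutator G := fun g h =>
    commutator_mem_commutator (mem_top _) (mem_top _)
  have hexp' : ∀ x ∈ commutator G, x ^ p = 1 := by
    intro x hx
    have := Monoid.pow_exponent_eq_one (⟨x, hx⟩ : commutator G)
    rw [hexp] at this
    exact congrArg Subtype.val this
  obtain ⟨L2, hL2⟩ : ∃ L, L = ⁅commutator G, (⊤ : Subgroup G)⁆ := ⟨_, rfl⟩
  obtain ⟨L3, hL3⟩ : ∃ L, L = ⁅L2, (⊤ : Subgroup G)⁆ := ⟨_, rfl⟩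
  have nL2 : L2.Normal := by rw [hL2]; infer_instance
  have nL3 : L3.Normal := by rw [hL3]; infer_instance
  have hL2A : L2 ≤ commutator G := by rw [hL2]; exact commutator_le_left _ _
  have hL3L2 : L3 ≤ L2 := by rw [hL3]; exact commutator_le_left _ _
  have m2 : ∀ g : G, ∀ u ∈ commutator G, ⁅g, u⁆ ∈ L2 := by
    intro g u hu
    rw [hL2, commutator_comm]; exact commutator_mem_commutator (mem_top _) hu
  have m3 : ∀ g : G, ∀ u ∈ L2, ⁅g, u⁆ ∈ L3 := by
    intro g u hu
    rw [hL3, commutator_comm]; exact commutator_mem_commutator (mem_top _) hu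
  have nb : ∀ U : Subgroup G, U ≤ ⁅U, (⊤ : Subgroup G)⁆ → U = ⊥ := by
    intro U hU
    exact le_bot_iff.1 (aux_nak U ⊥ (by simpa using hU))
  have hp1 := hp.one_lt
  have hL2lt : ¬ commutator G ≤ L2 := by
    intro h
    rw [hL2] at h
    have h1 := nb _ h
    rw [h1, Subgroup.card_bot] at hcard
    exact absurd hcard (Nat.one_lt_pow (by norm_num) hp1).ne
  have hR : ∀ g h : G, ⁅g, h⁆ ∈ L2 → g ∉ commutator G → h ∈ zpowers g ⊔ commutator G := by
    intro g h h1 h2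
    by_contra h3
    exact hL2lt (aux_gen L2 hL2.ge h1 (aux_top hp hG hcard h2 h3))
  have hZA : center G ≤ commutator G := by
    intro z hz
    by_contra hzA
    have ht : zpowers z ⊔ zpowers z ⊔ commutator G = ⊤ := by
      rw [sup_idem, eq_top_iff]
      intro h _
      refine hR z h ?_ hzA
      rw [commutatorElement_eq_one_iff_mul_comm.2 (mem_center_iff.1 hz h).symm]
      exact one_mem _
    exact hL2lt (aux_gen L2 hL2.ge (g := z) (h := z) (by simp [one_mem]) ht)
  obtain ⟨c, hc, hcA⟩ : ∃ c ∈ commutator G, zpowers c ⊔ L2 = commutator G := by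
    obtain ⟨a, b, hcab⟩ : ∃ a b : G, ⁅a, b⁆ ∉ L2 := by
      by_contra! h
      exact hL2lt ((commutator_le).2 fun x _ y _ => h x y)
    refine ⟨⁅a, b⁆, hcm _ _, le_antisymm (sup_le (zpowers_le.2 (hcm _ _)) hL2A) ?_⟩
    have : (zpowers ⁅a, b⁆ ⊔ L2).Normal := by
      rw [← commutator_top_right_le_iff]
      refine le_trans ?_ (le_sup_right (a := zpowers ⁅a, b⁆) (b := L2))
      conv_rhs => rw [hL2]
      exact commutator_mono (sup_le (zpowers_le.2 (hcm _ _)) hL2A) le_rfl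
    refine aux_gen _ (hL2.ge.trans le_sup_right) (g := a) (h := b)
      (mem_sup_left (mem_zpowers _)) (aux_top hp hG hcard ?_ ?_)
    · intro ha
      apply hcab
      rw [← commutatorElement_inv]
      exact inv_mem (m2 _ _ ha)
    · intro hb
      obtain ⟨x, hx, u, hu, rfl⟩ := mem_sup_of_normal_right.1 hb
      obtain ⟨k, rfl⟩ := mem_zpowers_iff.1 hx
      apply hcab
      rw [aux_self]
      exact nL2.conj_mem _ (m2 _ _ hu) _
  have hdec : ∀ u ∈ commutator G, ∃ k : ℤ, ∃ w ∈ L2, u = c ^ k * w := by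
    intro u hu
    rw [← hcA] at hu
    obtain ⟨x, hx, w, hw, rfl⟩ := mem_sup_of_normal_right.1 hu
    obtain ⟨k, rfl⟩ := mem_zpowers_iff.1 hx
    exact ⟨k, w, hw, rfl⟩
  have hzp : ∀ x ∈ commutator G, Nat.card (zpowers x) ≤ p := by
    intro x hx
    rw [Nat.card_zpowers]
    exact orderOf_le_of_pow_eq_one hp.pos (hexp' x hx)
  have hL2card : Nat.card L2 = p ^ 3 := by
    have h1 := aux_card_sup (zpowers c) L2
    rw [hcA, hcard] at h1
    have h2 := aux_lt_card hp hG (lt_of_le_not_ge hL2A hL2lt)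
    rw [hcard] at h2
    have h3 := h1.trans (Nat.mul_le_mul_right _ (hzp c hc))
    have h4 : Nat.card L2 * p = p ^ 3 * p := by
      apply le_antisymm
      · rw [← pow_succ]; exact h2
      · rw [← pow_succ, mul_comm]; exact h3
    exact Nat.eq_of_mul_eq_mul_right hp.pos h4
  have hD : ∀ g, Nat.card (auxD hab g).range ≤ p ^ 2 := by
    intro g
    have h1 := Subgroup.card_mul_index (auxD hab g).ker
    rw [Subgroup.index_ker, hcard] at h1
    have h2 : (center G).subgroupOf (commutator G) ≤ (auxD hab g).ker := by
      intro u hu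
      rw [mem_subgroupOf] at hu
      rw [MonoidHom.mem_ker]
      exact commutatorElement_eq_one_iff_mul_comm.2 (mem_center_iff.1 hu g)
    have h3 : Nat.card ((center G).subgroupOf (commutator G)) = p ^ 2 := by
      rw [← hZ]
      exact Nat.card_congr (Subgroup.subgroupOfEquivOfLe hZA).toEquiv
    have h4 := Subgroup.card_le_of_le h2
    rw [h3] at h4
    have h5 : p ^ 2 * Nat.card (auxD hab g).range ≤ p ^ 2 * p ^ 2 := by
      calc _ ≤ _ := Nat.mul_le_mul_right _ h4
        _ = p ^ 2 * p ^ 2 := by rw [h1]; ring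
    exact Nat.le_of_mul_le_mul_left h5 (pow_pos hp.pos 2)
  obtain ⟨φ, hφ⟩ : ∃ φ : G →* G ⧸ L3, ∀ g, φ g = ((⁅g, c⁆ : G) : G ⧸ L3) := by
    subst hL3; subst hL2
    exact ⟨auxPhi hab c hc, fun g => rfl⟩
  have hφ2 : ∀ (g : G) (k : ℤ), ∀ w ∈ L2, ((⁅g, c ^ k * w⁆ : G) : G ⧸ L3) = φ g ^ k := by
    intro g k w hw
    rw [aux_cmul_right hab g (zpow_mem hc k) (hL2A hw), aux_pow hab g hc, QuotientGroup.mk_mul,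
      (QuotientGroup.eq_one_iff _).2 (m3 g w hw), mul_one, hφ, QuotientGroup.mk_zpow]
  have hrange : φ.range = L2.map (QuotientGroup.mk' L3) := by
    apply le_antisymm
    · rintro _ ⟨g, rfl⟩
      exact ⟨⁅g, c⁆, m2 g c hc, (hφ g).symm⟩
    · rw [map_le_iff_le_comap]
      conv_lhs => rw [hL2]
      rw [commutator_le]
      intro u hu g _
      obtain ⟨k, w, hw, rfl⟩ := hdec u hu
      rw [← commutatorElement_inv]
      refine inv_mem ?_
      rw [mem_comap]
      refine ⟨g ^ k, ?_⟩
      rw [map_zpow]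
      exact (hφ2 g k w hw).symm
  have hAker : commutator G ≤ φ.ker := by
    intro u hu
    rw [MonoidHom.mem_ker, hφ, commutatorElement_eq_one_iff_mul_comm.2 (hab u hu c hc)]
    rfl
  have hker : φ.ker = commutator G := by
    by_contra hne
    have hlt : commutator G < φ.ker := lt_of_le_of_ne hAker (Ne.symm hne)
    have h5 := aux_lt_card hp hG hlt
    rw [hcard] at h5
    obtain ⟨g, hg⟩ : ∃ g, zpowers g ⊔ φ.ker = ⊤ := by
      by_cases hk : φ.ker = ⊤
      · exact ⟨1, by rw [hk]; simp⟩
      · obtain ⟨g, hg⟩ : ∃ g, g ∉ φ.ker := by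
          by_contra! h
          exact hk (eq_top_iff.2 fun x _ => h x)
        refine ⟨g, ?_⟩
        have h6 : φ.ker < zpowers g ⊔ φ.ker :=
          lt_of_le_not_ge le_sup_right fun hc => hg (hc (mem_sup_left (mem_zpowers g)))
        have h7 := aux_lt_card hp hG h6
        apply eq_top_of_le_card
        rw [hG]
        calc p ^ 6 = p ^ 4 * p * p := by ring
          _ ≤ _ := (Nat.mul_le_mul_right p h5).trans h7
    have := aux_D_normal hab g
    have h8 : L2 ≤ (auxD hab g).range ⊔ L3 := by
      conv_lhs => rw [hL2]
      rw [commutator_le]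
      intro u hu x _
      obtain ⟨k, w, hw, rfl⟩ := hdec u hu
      rw [← commutatorElement_inv]
      refine inv_mem ?_
      have hx : x ∈ zpowers g ⊔ φ.ker := hg ▸ mem_top x
      obtain ⟨y, hy, v, hv, rfl⟩ := mem_sup_of_normal_right.1 hx
      obtain ⟨n, rfl⟩ := mem_zpowers_iff.1 hy
      have e1 := hφ2 (g ^ n * v) k w hw
      rw [map_mul, MonoidHom.mem_ker.1 hv, mul_one, map_zpow, ← zpow_mul, hφ,
        ← QuotientGroup.mk_zpow, ← aux_pow hab g hc, eq_comm, QuotientGroup.eq] at e1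
      have e2 := mul_mem_sup (S := (auxD hab g).range)
        (MonoidHom.mem_range.2 ⟨⟨c ^ (n * k), zpow_mem hc _⟩, rfl⟩) e1
      have e3 : auxD hab g ⟨c ^ (n * k), zpow_mem hc _⟩ = ⁅g, c ^ (n * k)⁆ := rfl
      rw [e3, mul_inv_cancel_left] at e2
      exact e2
    rw [hL3] at h8
    have h9 := Subgroup.card_le_of_le (aux_nak _ _ h8)
    rw [hL2card] at h9
    have := h9.trans (hD g)
    exact absurd this (not_le.2 (Nat.pow_lt_pow_right hp1 (by norm_num)))
  have hL3card : Nat.card L3 = p := by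
    have h1 := Subgroup.card_mul_index φ.ker
    rw [Subgroup.index_ker, hker, hcard, hG, hrange] at h1
    have h2 := aux_card_map (QuotientGroup.mk' L3) L2 (by simpa using hL3L2)
    rw [QuotientGroup.ker_mk', hL2card] at h2
    have h3 : Nat.card (L2.map (QuotientGroup.mk' L3)) = p ^ 2 := by
      apply Nat.eq_of_mul_eq_mul_left (pow_pos hp.pos 4)
      rw [h1]; ring
    rw [h3] at h2
    apply Nat.eq_of_mul_eq_mul_left (pow_pos hp.pos 2)
    rw [h2]; ring
  have hL3Z : L3 ≤ center G := by
    rw [← commutator_top_right_eq_bot_iff_le_center]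
    by_contra hne
    have h1 : ⁅L3, (⊤ : Subgroup G)⁆ ≤ L3 := commutator_le_left _ _
    have h2 := aux_lt_card hp hG (bot_lt_iff_ne_bot.2 hne)
    rw [Subgroup.card_bot, one_mul] at h2
    have h3 := Subgroup.eq_of_le_of_card_ge h1 (hL3card.trans_le h2)
    have h4 := nb L3 h3.ge
    rw [h4, Subgroup.card_bot] at hL3card
    exact hp1.ne hL3card
  have hZL2 : center G ≤ L2 := by
    intro z hz
    by_contra hzL
    have h1 : L2 < zpowers z ⊔ L2 :=
      lt_of_le_not_ge le_sup_right fun hc => hzL (hc (mem_sup_left (mem_zpowers z)))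
    have h2 := aux_lt_card hp hG h1
    rw [hL2card] at h2
    have h3 : zpowers z ⊔ L2 = commutator G := by
      apply Subgroup.eq_of_le_of_card_ge (sup_le (zpowers_le.2 (hZA hz)) hL2A)
      rw [hcard, pow_succ]; exact h2
    have h4 : L2 ≤ L3 := by
      conv_lhs => rw [hL2]
      rw [commutator_le]
      intro u hu g _
      rw [← h3] at hu
      obtain ⟨y, hy, w, hw, rfl⟩ := mem_sup_of_normal_right.1 hu
      obtain ⟨n, rfl⟩ := mem_zpowers_iff.1 hy
      rw [← commutatorElement_inv]
      refine inv_mem ?_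
      rw [aux_cmul_right hab g (zpow_mem (hZA hz) n) (hL2A hw),
        commutatorElement_eq_one_iff_mul_comm.2 (mem_center_iff.1 (zpow_mem hz n) g), one_mul]
      exact m3 g w hw
    have h5 := Subgroup.card_le_of_le h4
    rw [hL3card, hL2card] at h5
    exact absurd h5 (not_le.2 (by simpa using Nat.pow_lt_pow_right (m := 1) (n := 3) hp1 (by norm_num)))
  obtain ⟨z0, hz0, hz0L⟩ : ∃ z ∈ center G, z ∉ L3 := by
    by_contra! h
    have h5 := Subgroup.card_le_of_le (show center G ≤ L3 from h)
    rw [hL3card, hZ] at h5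
    exact absurd h5 (not_le.2 (by simpa using Nat.pow_lt_pow_right (m := 1) (n := 2) hp1 (by norm_num)))
  obtain ⟨b, hb⟩ : (z0 : G ⧸ L3) ∈ φ.range := by
    rw [hrange]; exact ⟨z0, hZL2 hz0, rfl⟩
  obtain ⟨z, hzdef⟩ : ∃ z, z = ⁅b, c⁆ := ⟨_, rfl⟩
  rw [hφ, ← hzdef, eq_comm, QuotientGroup.eq] at hb
  have hzZ : z ∈ center G := by
    have := mul_mem hz0 (hL3Z hb)
    simpa using this
  have hzL : z ∉ L3 := by
    intro h
    have := mul_mem h (inv_mem hb)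
    simp at this
    exact hz0L this
  -- `b` centralizes `L2`
  have hbL2 : ∀ w ∈ L2, ⁅b, w⁆ = 1 := by
    intro w hw
    obtain ⟨g, hg⟩ : (w : G ⧸ L3) ∈ φ.range := by
      rw [hrange]; exact ⟨w, hw, rfl⟩
    rw [hφ, QuotientGroup.eq] at hg
    have e1 : w = ⁅g, c⁆ * (⁅g, c⁆⁻¹ * w) := by group
    have e2 : b * c * b⁻¹ = z * c := by rw [hzdef]; simp [commutatorElement_def]
    have e3 : b * ⁅g, c⁆ * b⁻¹ = ⁅g, c⁆ := by
      rw [aux_conj hab b g hc, e2, aux_cmul_right hab g (hZA hzZ) hc,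
        commutatorElement_eq_one_iff_mul_comm.2 (mem_center_iff.1 hzZ g), one_mul]
    rw [e1, aux_cmul_right hab b (hcm _ _) (hL2A (hL3L2 hg)),
      commutatorElement_eq_one_iff_mul_comm.2 (mem_center_iff.1 (hL3Z hg) b), mul_one,
      commutatorElement_def, e3, mul_inv_cancel]
  have hbA : ∀ v ∈ commutator G, ⁅b, v⁆ ∈ zpowers z := by
    intro v hv
    obtain ⟨k, w, hw, rfl⟩ := hdec v hv
    rw [aux_cmul_right hab b (zpow_mem hc k) (hL2A hw), hbL2 w hw, mul_one, aux_pow hab b hc,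
      ← hzdef]
    exact zpow_mem (mem_zpowers z) k
  have nz : (zpowers z).Normal := by
    constructor
    intro x hx g
    have : x ∈ center G := (zpowers_le.2 hzZ) hx
    rw [mem_center_iff.1 this g, mul_inv_cancel_right]
    exact hx
  have hbs : ∀ (s : ℤ), ∀ v ∈ commutator G, ⁅b ^ s, v⁆ ∈ zpowers z := by
    intro s v hv
    rw [aux_mem_iff]
    have := (aux_mem_iff (zpowers z) b v).1 (hbA v hv)
    rw [QuotientGroup.mk_zpow]
    exact this.zpow_left s
  obtain ⟨w, hw, hw1⟩ : ∃ w ∈ L3, w ≠ 1 := by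
    by_contra! h
    rw [(Subgroup.eq_bot_iff_forall _).2 h, Subgroup.card_bot] at hL3card
    exact hp1.ne hL3card
  intro hKG
  have hmem : z * w ∈ commutatorSet G := by
    rw [hKG]
    exact mul_mem (hZA hzZ) (hL2A (hL3L2 hw))
  have hform : ∃ k : G, ∃ v ∈ commutator G, z * w = ⁅k, v⁆ := by
    obtain ⟨g, h, hgh⟩ := hmem
    by_cases hg : g ∈ commutator G
    · refine ⟨h, g⁻¹, inv_mem hg, ?_⟩
      have := aux_pow hab h hg (-1)
      rw [zpow_neg_one, zpow_neg_one] at this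
      rw [this, commutatorElement_inv, hgh]
    · have h1 : ⁅g, h⁆ ∈ L2 := by
        rw [hgh]; exact mul_mem (hZL2 hzZ) (hL3L2 hw)
      obtain ⟨x, hx, u, hu, rfl⟩ := mem_sup_of_normal_right.1 (hR g h h1 hg)
      obtain ⟨k, rfl⟩ := mem_zpowers_iff.1 hx
      refine ⟨g, g ^ k * u * (g ^ k)⁻¹, Normal.conj_mem inferInstance _ hu _, ?_⟩
      rw [← hgh, aux_self, aux_conj hab _ g hu]
  obtain ⟨k, v, hv, hkv⟩ := hform
  obtain ⟨t, w', hw', hvt⟩ := hdec v hv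
  have hφz : φ b = φ k ^ t := by
    rw [← hφ2 k t w' hw', ← hvt, ← hkv, hφ, ← hzdef, QuotientGroup.mk_mul,
      (QuotientGroup.eq_one_iff w).2 hw, mul_one]
  have hφp : φ k ^ (p : ℤ) = 1 := by
    rw [hφ, zpow_natCast, ← QuotientGroup.mk_pow, hexp' _ (hcm _ _)]
    rfl
  have htp : ¬ (p : ℤ) ∣ t := by
    rintro ⟨m, rfl⟩
    rw [zpow_mul, hφp, one_zpow, hφ, ← hzdef, QuotientGroup.eq_one_iff] at hφz
    exact hzL hφz
  have hcop : IsCoprime t (p : ℤ) :=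
    ((Prime.coprime_iff_not_dvd (Nat.prime_iff_prime_int.1 hp)).2 htp).symm
  obtain ⟨s, r, hsr⟩ := hcop
  have hkb : φ k = φ (b ^ s) := by
    rw [map_zpow, hφz, ← zpow_mul]
    conv_lhs => rw [← zpow_one (φ k), ← hsr, zpow_add, mul_comm r, zpow_mul _ (p : ℤ), hφp,
      one_zpow, mul_one, mul_comm s]
  have hka : (b ^ s)⁻¹ * k ∈ commutator G := by
    rw [← hker, MonoidHom.mem_ker, map_mul, map_inv, hkb, inv_mul_cancel]
  have hzw : z * w ∈ zpowers z := by
    have e : k = b ^ s * ((b ^ s)⁻¹ * k) := by group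
    rw [hkv, e, aux_cmul_left hab _ hka hv]
    exact hbs s v hv
  have hwz : w ∈ zpowers z := (Subgroup.mul_mem_cancel_left _ (mem_zpowers z)).1 hzw
  have hww : p ≤ Nat.card (zpowers w) := by
    have := aux_lt_card hp hG (bot_lt_iff_ne_bot.2 (zpowers_ne_bot.2 hw1))
    rwa [Subgroup.card_bot, one_mul] at this
  have hz' := Subgroup.eq_of_le_of_card_ge (zpowers_le.2 hwz) ((hzp z (hZA hzZ)).trans hww)
  have : z ∈ zpowers w := hz' ▸ mem_zpowers z
  exact hzL ((zpowers_le.2 hw) this)
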